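/- Let (W,S) be a Coxeter system and let r, t ∈ S with r ≠ t. Suppose s_1 s_2 ⋯ s_k (with s_i ∈ S) equals in W the alternating word rtr⋯ of length j, where j ≤ m_{r,t}. Then there exist indices i_1 < i_2 < ⋯ < i_j such that the word s_{i_1} s_{i_2} ⋯ s_{i_j} is, letter for letter, the alternating word rtr⋯ of length j (or possibly the alternating word trt⋯ of length j in the case j = m_{r,t}). -/

import Mathlib

open CoxeterSystem

namespace CoxFA

variable {B : Type*}

section GeometricRepresentation

variable (M : CoxeterMatrix B)

/-- The simple coroot of `i`: the linear form sending the basis vector of `k` to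
`-2 cos (π / M i k)`. When `M i k = 0` the value is `-2`, by the convention `π / 0 = 0`. -/
noncomputable def coroot (i : B) : Module.Dual ℝ (B →₀ ℝ) :=
  Finsupp.linearCombination ℝ fun k ↦ -2 * Real.cos (Real.pi / M i k)

theorem coroot_single (i k : B) :
    coroot M i (Finsupp.single k 1) = -2 * Real.cos (Real.pi / M i k) := by
  simp [coroot]

theorem coroot_self (i : B) : coroot M i (Finsupp.single i 1) = 2 := by
  simp [coroot_single]

/-- The reflection in the simple root of `i`. -/
noncomputable def simpleReflection (i : B) : (B →₀ ℝ) ≃ₗ[ℝ] (B →₀ ℝ) :=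
  Module.reflection (coroot_self M i)

theorem simpleReflection_apply (i : B) (v : B →₀ ℝ) :
    simpleReflection M i v = v - coroot M i v • Finsupp.single i 1 :=
  Module.reflection_apply _ _

theorem simpleReflection_mul_self (i : B) : simpleReflection M i * simpleReflection M i = 1 :=
  LinearEquiv.ext (Module.involutive_reflection (coroot_self M i))

open Polynomial.Chebyshev in
theorem isLiftable_simpleReflection : M.IsLiftable (simpleReflection M) := by
  intro i k
  by_cases hik : i = k
  · subst hik
    rw [M.diagonal, pow_one, simpleReflection_mul_self]
  have hm1 := M.off_diagonal i k hik
  obtain ⟨m, hm⟩ : ∃ m, M i k = m := ⟨_, rfl⟩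
  have hm' : M k i = m := by rw [M.symmetric, hm]
  change M i k ≠ 1 at hm1
  rw [hm] at hm1 ⊢
  rcases eq_or_ne m 0 with rfl | hm0
  · exact pow_zero _
  ext1 z
  have hf : coroot M i (Finsupp.single k 1) = -2 * Real.cos (Real.pi / m) := by
    rw [coroot_single, hm]
  have hg : coroot M k (Finsupp.single i 1) = -2 * Real.cos (Real.pi / m) := by
    rw [coroot_single, hm']
  rcases eq_or_ne m 2 with rfl | hm2
  · have hc : Real.cos (Real.pi / (2 : ℕ)) = 0 := by simp
    rw [hc, mul_zero] at hf hg
    simp only [pow_two, LinearEquiv.mul_apply, simpleReflection_apply, map_sub, map_smul, hf, hg,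
      coroot_self, LinearEquiv.coe_one, id_eq]
    module
  set θ : ℝ := 2 * (Real.pi / m) with hθ
  have hmpos : (0 : ℝ) < m := by positivity
  have hsin : Real.sin θ ≠ 0 := by
    apply (Real.sin_pos_of_pos_of_lt_pi (by positivity) _).ne'
    have h3 : (3 : ℝ) ≤ m := by exact_mod_cast (by lia : 3 ≤ m)
    rw [hθ, ← mul_div_assoc, div_lt_iff₀ hmpos]
    nlinarith [Real.pi_pos]
  have ht : 2 * Real.cos θ =
      coroot M i (Finsupp.single k 1) * coroot M k (Finsupp.single i 1) - 2 := by
    rw [hf, hg, hθ, Real.cos_two_mul]; ring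
  have hS (n : ℤ) := S_two_mul_real_cos θ n
  simp only [simpleReflection]
  rw [Module.reflection_mul_reflection_pow_apply _ _ m z (2 * Real.cos θ) ht]
  rcases Nat.even_or_odd' m with ⟨k, rfl | rfl⟩
  · have hk0 : (k : ℝ) ≠ 0 := by exact_mod_cast (by lia : k ≠ 0)
    have h0 : (S ℝ (k - 1)).eval (2 * Real.cos θ) = 0 := by
      apply (mul_eq_zero.mp ((hS _).trans _)).resolve_right hsin
      have : (((k - 1 : ℤ) : ℝ) + 1) * θ = Real.pi := by
        rw [hθ]; push_cast; field_simp; ring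
      rw [this, Real.sin_pi]
    have e1 : (((2 * k : ℕ) : ℤ) - 2) / 2 = k - 1 := by lia
    have e2 : (((2 * k : ℕ) : ℤ) - 1) / 2 = k - 1 := by lia
    rw [e1, e2, h0]
    simp
  · have h0 : (S ℝ k).eval (2 * Real.cos θ) + (S ℝ (k - 1)).eval (2 * Real.cos θ) = 0 := by
      apply (mul_eq_zero.mp (_ : _ * Real.sin θ = 0)).resolve_right hsin
      rw [add_mul, hS, hS]
      have : (((k - 1 : ℤ) : ℝ) + 1) * θ = 2 * Real.pi - (((k : ℤ) : ℝ) + 1) * θ := by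
        rw [hθ]; push_cast at hmpos ⊢; field_simp; ring
      rw [this, Real.sin_two_pi_sub, add_neg_cancel]
    have e1 : (((2 * k + 1 : ℕ) : ℤ) - 3) / 2 = k - 1 := by lia
    have e2 : (((2 * k + 1 : ℕ) : ℤ) - 1) / 2 = k := by lia
    have e3 : (((2 * k + 1 : ℕ) : ℤ)) / 2 = k := by lia
    have e4 : (((2 * k + 1 : ℕ) : ℤ) - 2) / 2 = k - 1 := by lia
    rw [e1, e2, e3, e4, h0]
    simp

variable {M} {W : Type*} [Group W] (cs : CoxeterSystem M W)

/-- The geometric representation of a Coxeter group. -/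
noncomputable def geometricRep : W →* ((B →₀ ℝ) ≃ₗ[ℝ] (B →₀ ℝ)) :=
  cs.lift ⟨simpleReflection M, isLiftable_simpleReflection M⟩

theorem geometricRep_simple (i : B) : geometricRep cs (cs.simple i) = simpleReflection M i :=
  cs.lift_apply_simple (isLiftable_simpleReflection M) i

theorem geometricRep_wordProd_apply_of_notMem {i : B} {ω : List B} (hi : i ∉ ω) (v : B →₀ ℝ) :
    geometricRep cs (cs.wordProd ω) v i = v i := by
  induction ω with
  | nil => simp
  | cons k ω ih =>
    rw [List.mem_cons, not_or] at hi
    rw [cs.wordProd_cons, map_mul, LinearEquiv.mul_apply, geometricRep_simple,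
      simpleReflection_apply, Finsupp.sub_apply, ih hi.2, Finsupp.smul_apply,
      Finsupp.single_eq_of_ne hi.1]
    simp

theorem mem_of_simple_eq_wordProd {i : B} {ω : List B} (h : cs.simple i = cs.wordProd ω) :
    i ∈ ω := by
  by_contra hi
  have key := geometricRep_wordProd_apply_of_notMem cs hi (Finsupp.single i 1)
  rw [← h, geometricRep_simple, simpleReflection_apply, coroot_self] at key
  norm_num at key

theorem dvd_of_simple_mul_simple_pow_eq_one {r t : B} (hrt : r ≠ t) {n : ℕ}
    (h : (cs.simple r * cs.simple t) ^ n = 1) : M r t ∣ n := by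
  obtain ⟨m, hm⟩ : ∃ m, M r t = m := ⟨_, rfl⟩
  have hm1 : M r t ≠ 1 := M.off_diagonal r t hrt
  have hf : coroot M r (Finsupp.single t 1) = -2 * Real.cos (Real.pi / m) := by
    rw [coroot_single, hm]
  have hg : coroot M t (Finsupp.single r 1) = -2 * Real.cos (Real.pi / m) := by
    rw [coroot_single, M.symmetric, hm]
  rw [hm] at hm1 ⊢
  have hrep := congrArg (geometricRep cs) h
  rw [map_pow, map_mul, geometricRep_simple, geometricRep_simple, map_one] at hrep
  have step (x y : ℝ) :
      (simpleReflection M r * simpleReflection M t)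
        (x • Finsupp.single r 1 + y • Finsupp.single t 1) =
      (2 * Real.cos (Real.pi / m) * (2 * Real.cos (Real.pi / m) * x - y) - x) •
          Finsupp.single r 1 +
        (2 * Real.cos (Real.pi / m) * x - y) • Finsupp.single t 1 := by
    simp only [LinearEquiv.mul_apply, simpleReflection_apply, map_add, map_sub, map_smul, hf, hg,
      coroot_self]
    module
  have coeff {x y x' y' : ℝ} (e : x • Finsupp.single r (1 : ℝ) + y • Finsupp.single t 1 =
      x' • Finsupp.single r 1 + y' • Finsupp.single t 1) : x = x' ∧ y = y' := by
    constructor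
    · simpa [hrt, hrt.symm] using DFunLike.congr_fun e r
    · simpa [hrt, hrt.symm] using DFunLike.congr_fun e t
  rcases eq_or_ne m 0 with rfl | hm0
  · have key (n : ℕ) : ((simpleReflection M r * simpleReflection M t) ^ n)
        ((1 : ℝ) • Finsupp.single r 1 + (0 : ℝ) • Finsupp.single t 1) =
        (2 * n + 1 : ℝ) • Finsupp.single r 1 + (2 * n : ℝ) • Finsupp.single t 1 := by
      induction n with
      | zero => simp
      | succ n ih =>
        rw [pow_succ', LinearEquiv.mul_apply, ih, step]
        simp only [Nat.cast_zero, div_zero, Real.cos_zero]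
        push_cast
        congr 2 <;> ring
    have e := key n
    rw [hrep, LinearEquiv.coe_one, id_eq] at e
    have := (coeff e).2
    have : n = 0 := by
      have : (n : ℝ) = 0 := by linarith
      exact_mod_cast this
    simp [this]
  set a := Real.pi / m with ha
  have hmpos : (0 : ℝ) < m := by positivity
  have hsin : Real.sin a ≠ 0 := by
    apply (Real.sin_pos_of_pos_of_lt_pi (by positivity) _).ne'
    have h2 : (2 : ℝ) ≤ m := by exact_mod_cast (by lia : 2 ≤ m)
    rw [ha, div_lt_iff₀ hmpos]
    nlinarith [Real.pi_pos]
  have sin_step (u : ℝ) : 2 * Real.cos a * Real.sin (u + a) - Real.sin u = Real.sin (u + 2 * a) := by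
    rw [Real.sin_add, Real.sin_add, Real.sin_two_mul, Real.cos_two_mul]
    ring
  have key (n : ℕ) : ((simpleReflection M r * simpleReflection M t) ^ n)
      (Real.sin a • Finsupp.single r 1 + (0 : ℝ) • Finsupp.single t 1) =
      Real.sin (2 * n * a + a) • Finsupp.single r 1 +
        Real.sin (2 * n * a) • Finsupp.single t 1 := by
    induction n with
    | zero => simp
    | succ n ih =>
      rw [pow_succ', LinearEquiv.mul_apply, ih, step, sin_step,
        show 2 * n * a + 2 * a = 2 * n * a + a + a by ring, sin_step]
      push_cast
      congr 3 <;> ring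
  have e := key n
  rw [hrep, LinearEquiv.coe_one, id_eq] at e
  obtain ⟨hx, hy⟩ := coeff e
  rw [Real.sin_add, ← hy, zero_mul, zero_add] at hx
  have hcos : Real.cos (2 * n * a) = 1 := by
    apply mul_right_cancel₀ hsin
    rw [← hx, one_mul]
  obtain ⟨k, hk⟩ := (Real.cos_eq_one_iff _).mp hcos
  have hkn : (k : ℝ) * m = n := by
    rw [ha] at hk
    field_simp at hk
    linarith
  exact Int.natCast_dvd_natCast.mp ⟨k, by rw [mul_comm]; exact_mod_cast hkn.symm⟩

end GeometricRepresentation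

section InversionSequences

variable {M : CoxeterMatrix B} {W : Type*} [Group W] (cs : CoxeterSystem M W)

theorem rightInvSeq_alternatingWord (r t : B) (j : ℕ) :
    cs.rightInvSeq (alternatingWord r t j) =
      ((List.range j).map fun k ↦ cs.simple t * (cs.simple r * cs.simple t) ^ k).reverse := by
  induction j generalizing r t with
  | zero => simp [alternatingWord]
  | succ j ih =>
    rw [alternatingWord_succ, cs.rightInvSeq_concat, ih, List.range_succ_eq_map]
    have (k : ℕ) : cs.simple t * (cs.simple r * (cs.simple t * cs.simple r) ^ k) * cs.simple t =
        cs.simple t * (cs.simple r * cs.simple t) ^ (k + 1) := by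
      rw [← mul_pow_mul, pow_succ]
      simp only [mul_assoc]
    simp [Function.comp_def, this]

open Classical in
/-- A simple reflection acting on pairs of a group element and a sign: it conjugates the
element and flips the sign when the element is the reflection itself. -/
noncomputable def signedConj (i : B) : Function.End (W × ZMod 2) := fun p ↦
  (cs.simple i * p.1 * cs.simple i, p.2 + if p.1 = cs.simple i then 1 else 0)

open Classical in
theorem prod_map_signedConj_apply (ω : List B) (x : W) (ε : ZMod 2) :
    (ω.map (signedConj cs)).prod (x, ε) =
      (cs.wordProd ω * x * (cs.wordProd ω)⁻¹, ε + (cs.rightInvSeq ω).count x) := by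
  induction ω with
  | nil => simp; rfl
  | cons i ω ih =>
    rw [List.map_cons, List.prod_cons]
    change signedConj cs i ((ω.map (signedConj cs)).prod (x, ε)) = _
    rw [ih]
    have : cs.wordProd ω * x * (cs.wordProd ω)⁻¹ = cs.simple i ↔
        (cs.wordProd ω)⁻¹ * cs.simple i * cs.wordProd ω = x := by
      rw [mul_inv_eq_iff_eq_mul, mul_assoc, inv_mul_eq_iff_eq_mul, eq_comm]
    simp only [signedConj, this, CoxeterSystem.rightInvSeq, List.count_cons, cs.wordProd_cons,
      beq_iff_eq]
    ext
    · simp [mul_assoc]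
    · push_cast
      simp [add_assoc]

theorem isLiftable_signedConj : M.IsLiftable (signedConj cs) := by
  classical
  intro r t
  have hprod (n : ℕ) : ((alternatingWord r t (2 * n)).map (signedConj cs)).prod =
      (signedConj cs r * signedConj cs t) ^ n := by
    induction n with
    | zero => simp [alternatingWord]
    | succ n ih =>
      rw [show 2 * (n + 1) = 2 * n + 1 + 1 by ring, alternatingWord_succ, alternatingWord_succ]
      simp only [List.concat_eq_append, List.map_append, List.prod_append, ih, pow_succ]
      simp [mul_assoc]
  rw [← hprod]
  funext ⟨x, ε⟩
  rw [prod_map_signedConj_apply, rightInvSeq_alternatingWord,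
    cs.prod_alternatingWord_eq_mul_pow, two_mul, List.range_add]
  have hc : (M r t + M r t) / 2 = M r t := by lia
  simp [Function.comp_def, pow_add, hc, CharTwo.add_self_eq_zero]
  rfl

open Classical in
theorem count_rightInvSeq_eq_of_wordProd_eq {ω ω' : List B}
    (h : cs.wordProd ω = cs.wordProd ω') (x : W) :
    ((cs.rightInvSeq ω).count x : ZMod 2) = (cs.rightInvSeq ω').count x := by
  have key (ω : List B) : cs.lift ⟨signedConj cs, isLiftable_signedConj cs⟩ (cs.wordProd ω) =
      (ω.map (signedConj cs)).prod := by
    rw [CoxeterSystem.wordProd, map_list_prod, List.map_map]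
    congr 2
    funext i
    exact cs.lift_apply_simple (isLiftable_signedConj cs) i
  have := congrArg (fun f : Function.End (W × ZMod 2) ↦ (f (x, 0)).2)
    ((key ω).symm.trans ((congrArg _ h).trans (key ω')))
  simpa [prod_map_signedConj_apply] using this

theorem rightInvSeq_perm_of_wordProd_eq {ω ω' : List B} (h : cs.wordProd ω = cs.wordProd ω')
    (hω : (cs.rightInvSeq ω).Nodup) (hω' : (cs.rightInvSeq ω').Nodup) :
    (cs.rightInvSeq ω).Perm (cs.rightInvSeq ω') := by
  classical
  rw [List.perm_ext_iff_of_nodup hω hω']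
  intro x
  have := count_rightInvSeq_eq_of_wordProd_eq cs h x
  rw [List.Nodup.count hω, List.Nodup.count hω'] at this
  split_ifs at this <;> simp_all

theorem exists_sublist_of_mem_rightInvSeq {ω : List B} {x : W} (hx : x ∈ cs.rightInvSeq ω) :
    ∃ ω' : List B, ω'.Sublist ω ∧ ω'.length < ω.length ∧
      cs.wordProd ω' = cs.wordProd ω * x := by
  obtain ⟨k, hk, rfl⟩ := List.getElem_of_mem hx
  refine ⟨ω.eraseIdx k, List.eraseIdx_sublist _ _, ?_, ?_⟩
  · rw [cs.length_rightInvSeq] at hk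
    rw [List.length_eraseIdx_of_lt hk]
    lia
  · rw [← cs.wordProd_mul_getD_rightInvSeq, List.getD_eq_getElem _ _ hk]

theorem exists_sublist_of_not_nodup_rightInvSeq {ω : List B}
    (hω : ¬ (cs.rightInvSeq ω).Nodup) :
    ∃ ω' : List B, ω'.Sublist ω ∧ ω'.length < ω.length ∧ cs.wordProd ω' = cs.wordProd ω := by
  induction ω with
  | nil => simp at hω
  | cons i ω ih =>
    rw [CoxeterSystem.rightInvSeq, List.nodup_cons, not_and_or, not_not] at hω
    rcases hω with hmem | hnd
    · obtain ⟨ω', hsub, hlen, hprod⟩ := exists_sublist_of_mem_rightInvSeq cs hmem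
      refine ⟨ω', hsub.cons i, by simp; lia, ?_⟩
      rw [hprod, cs.wordProd_cons]
      group
    · obtain ⟨ω', hsub, hlen, hprod⟩ := ih hnd
      exact ⟨i :: ω', hsub.cons_cons i, by simpa, by rw [cs.wordProd_cons, cs.wordProd_cons, hprod]⟩

theorem exists_sublist_nodup_rightInvSeq (ω : List B) :
    ∃ ω' : List B, ω'.Sublist ω ∧ cs.wordProd ω' = cs.wordProd ω ∧
      (cs.rightInvSeq ω').Nodup := by
  induction hn : ω.length using Nat.strong_induction_on generalizing ω with
  | _ n ih =>
    by_cases hω : (cs.rightInvSeq ω).Nodup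
    · exact ⟨ω, .refl ω, rfl, hω⟩
    · obtain ⟨ω₁, hsub₁, hlen, hprod₁⟩ := exists_sublist_of_not_nodup_rightInvSeq cs hω
      obtain ⟨ω₂, hsub₂, hprod₂, hnd⟩ := ih _ (hn ▸ hlen) ω₁ rfl
      exact ⟨ω₂, hsub₂.trans hsub₁, hprod₂.trans hprod₁, hnd⟩

theorem nodup_rightInvSeq_alternatingWord {r t : B} (hrt : r ≠ t) {j : ℕ}
    (hj : M r t = 0 ∨ j ≤ M r t) : (cs.rightInvSeq (alternatingWord r t j)).Nodup := by
  rw [rightInvSeq_alternatingWord, List.nodup_reverse]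
  refine List.Nodup.map_on ?_ List.nodup_range
  have aux {k l : ℕ} (hkl : k ≤ l) (hl : l < j) (e : cs.simple t * (cs.simple r * cs.simple t) ^ k =
      cs.simple t * (cs.simple r * cs.simple t) ^ l) : k = l := by
    obtain ⟨d, rfl⟩ := Nat.exists_eq_add_of_le hkl
    rw [mul_right_inj, pow_add, left_eq_mul] at e
    have hdvd := dvd_of_simple_mul_simple_pow_eq_one cs hrt e
    rcases hj with h0 | hj
    · rw [h0, zero_dvd_iff] at hdvd
      lia
    · have := Nat.eq_zero_of_dvd_of_lt hdvd (by lia)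
      lia
  intro k hk l hl e
  rw [List.mem_range] at hk hl
  rcases le_total k l with hkl | hkl
  · exact aux hkl hl e
  · exact (aux hkl hk e.symm).symm

theorem eq_or_eq_of_mem_alternatingWord {i r t : B} {j : ℕ} (h : i ∈ alternatingWord r t j) :
    i = r ∨ i = t := by
  induction j generalizing r t with
  | zero => simp [alternatingWord] at h
  | succ j ih =>
    rw [alternatingWord_succ, List.concat_eq_append, List.mem_append, List.mem_singleton] at h
    exact h.elim (fun h ↦ (ih h).symm) .inr

theorem eq_alternatingWord_of_nodup_rightInvSeq {r t : B} (hrt : r ≠ t) {j : ℕ}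
    (hj : M r t = 0 ∨ j ≤ M r t) {ω : List B} (hω : (cs.rightInvSeq ω).Nodup)
    (h : cs.wordProd ω = cs.wordProd (alternatingWord r t j)) :
    ω = alternatingWord r t j ∨ (j = M r t ∧ ω = alternatingWord t r j) := by
  induction j generalizing r t ω with
  | zero =>
    have hperm := rightInvSeq_perm_of_wordProd_eq cs h hω
      (nodup_rightInvSeq_alternatingWord cs hrt hj)
    left
    simpa [alternatingWord] using hperm.length_eq
  | succ j ih =>
    have hperm := rightInvSeq_perm_of_wordProd_eq cs h hω
      (nodup_rightInvSeq_alternatingWord cs hrt hj)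
    have strip {a b : B} (hab : a ≠ b) (hM : M a b = M r t) {ω' : List B}
        (hnd : (cs.rightInvSeq ω').Nodup)
        (hprod : cs.wordProd ω' = cs.wordProd (alternatingWord a b j)) :
        ω' = alternatingWord a b j := by
      rcases ih hab (by rw [hM]; lia) hnd hprod with h1 | ⟨h1, h2⟩
      · exact h1
      · obtain rfl : j = 0 := by lia
        exact h2
    rcases List.eq_nil_or_concat ω with rfl | ⟨ω', i, rfl⟩
    · simpa using hperm.length_eq
    rw [cs.rightInvSeq_concat] at hω hperm
    rw [List.concat_eq_append] at hω hperm
    have hnd : (cs.rightInvSeq ω').Nodup := (List.nodup_append.mp hω).1.of_map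
    have hi := hperm.subset (List.mem_append_right _ (List.mem_singleton_self _))
    rw [rightInvSeq_alternatingWord, List.mem_reverse, List.mem_map] at hi
    obtain ⟨k, hk, hik⟩ := hi
    rw [List.mem_range] at hk
    have hword : cs.simple i = cs.wordProd (alternatingWord r t (2 * k + 1)) := by
      rw [cs.prod_alternatingWord_eq_mul_pow, ← hik, if_neg (by simp),
        show (2 * k + 1) / 2 = k by lia]
    rcases eq_or_eq_of_mem_alternatingWord (mem_of_simple_eq_wordProd cs hword) with rfl | rfl
    · right
      have hpow : (cs.simple i * cs.simple t) ^ (k + 1) = 1 := by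
        rw [pow_succ', mul_assoc, hik, cs.simple_mul_simple_self]
      have hdvd := dvd_of_simple_mul_simple_pow_eq_one cs hrt hpow
      have hle := Nat.le_of_dvd k.succ_pos hdvd
      have hj' : j + 1 = M i t := by
        rcases hj with h0 | hj
        · rw [h0, zero_dvd_iff] at hdvd
          lia
        · lia
      refine ⟨hj', ?_⟩
      have hbraid := cs.wordProd_braidWord_eq i t
      rw [braidWord, braidWord, M.symmetric t i, ← hj', ← h, alternatingWord_succ t i,
        cs.wordProd_concat, cs.wordProd_concat, mul_left_inj] at hbraid
      rw [alternatingWord_succ, strip hrt rfl hnd hbraid]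
    · left
      rw [alternatingWord_succ, cs.wordProd_concat, cs.wordProd_concat, mul_left_inj] at h
      rw [alternatingWord_succ, strip hrt.symm (M.symmetric _ _) hnd h]

end InversionSequences

/-- If a word `s₁ s₂ ⋯ s_k` equals in `W` the alternating word in `r` and
`t` of length `j ≤ m_{r,t}`, then some subsequence of it is, letter for letter, the
alternating word in `r` and `t` of length `j` (or possibly the alternating word with the
roles of `r` and `t` exchanged, in the case `j = m_{r,t}`). -/
theorem stmt_10 {W : Type*} [Group W] [Fintype B] {M : CoxeterMatrix B}
    (cs : CoxeterSystem M W) (r t : B) (hrt : r ≠ t) (j : ℕ)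
    (hj : M r t = 0 ∨ j ≤ M r t) (ω : List B)
    (h : cs.wordProd ω = cs.wordProd (alternatingWord r t j)) :
    ∃ ω' : List B, ω'.Sublist ω ∧
      (ω' = alternatingWord r t j ∨ (j = M r t ∧ ω' = alternatingWord t r j)) := by
  obtain ⟨ω', hsub, hprod, hnd⟩ := exists_sublist_nodup_rightInvSeq cs ω
  exact ⟨ω', hsub, eq_alternatingWord_of_nodup_rightInvSeq cs hrt hj hnd (hprod.trans h)⟩

end CoxFA
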